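/- Let A be a complex Banach algebra with a right identity u, let B be a semisimple complex Banach algebra (Jacobson radical zero), and let θ, φ, γ, η₁, η₂ be nonzero multiplicative linear functionals on B with θ ≠ φ. If d ∈ Der_J(A ×_θ^{φ,γ} B) is (η₁,η₂)-centralizing, i.e. d(a,b)·_{η₁}(a,b) − (a,b)·_{η₂} d(a,b) ∈ Z(A) × Z(B) for all a ∈ A and b ∈ B, then d = 0. -/

import Mathlib

/-- The ψ-product on `A × B` (Lau product multiplication):
`(a,b)·_ψ(x,y) = (a x + ψ(y) a + ψ(b) x, b y)`. -/
def lauMul {A B : Type*} [NonUnitalNonAssocSemiring A] [NonUnitalNonAssocSemiring B]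
    [Module ℂ A] [Module ℂ B] (ψ : B →ₗ[ℂ] ℂ) (p q : A × B) : A × B :=
  (p.1 * q.1 + ψ q.2 • p.1 + ψ p.2 • q.1, p.2 * q.2)

set_option linter.unusedSectionVars false
set_option linter.style.haveILetI false
section alg
variable {R : Type*} [NonUnitalRing R]

theorem sp_anti (h2 : ∀ x : R, x + x = 0 → x = 0) (hs : ∀ a : R, (∀ z, a * z * a = 0) → a = 0)
  (a b : R) (h : ∀ c, a * c * b + b * c * a = 0) (c : R) : a * c * b = 0 := by
  apply hs
  intro z
  apply h2
  have e1 := h (c * b * z * a * c)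
  have e2 := congrArg (fun t => a * c * b * z * t) (h c)
  have e3 := congrArg (fun t => t * c * a) (h (c * b * z))
  simp only [mul_zero, zero_mul] at e2 e3
  linear_combination (norm := noncomm_ring) e1 + e2 - e3

theorem sp_lin (hs : ∀ a : R, (∀ z, a * z * a = 0) → a = 0)
  (f g : R → R) (hf : ∀ a b, f (a + b) = f a + f b) (hg : ∀ a b, g (a + b) = g a + g b)
  (h : ∀ a c, f a * c * g a = 0) (a x c : R) : f a * c * g x = 0 := by
  have e : ∀ c, f a * c * g x + f x * c * g a = 0 := by
    intro c
    have := h (a + x) c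
    simp only [hf, hg, add_mul, mul_add, h] at this
    linear_combination (norm := noncomm_ring) this
  apply hs
  intro z
  have e1 := congrArg (fun t => f a * c * g x * z * t) (e c)
  have e2 := h a (c * g x * z * f x * c)
  simp only [mul_zero] at e1
  linear_combination (norm := noncomm_ring) e1 - e2

theorem sp_central (hs : ∀ a : R, (∀ z, a * z * a = 0) → a = 0) (p : R)
  (h : ∀ c x y, p * c * (x * y - y * x) = 0) (w : R) : p * w = w * p := by
  rw [← sub_eq_zero]
  apply hs
  intro z
  have e1 := h (w * z) p w
  have e2 := congrArg (fun t => w * t) (h z p w)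
  simp only [mul_zero] at e2
  linear_combination (norm := noncomm_ring) e1 - e2

theorem sp_sq (hs : ∀ a : R, (∀ z, a * z * a = 0) → a = 0) (t : R) (ht : ∀ y, t * y = y * t)
    (h : t * t = 0) : t = 0 := by
  apply hs; intro z; rw [ht z, mul_assoc, h, mul_zero]

theorem comm_of_centr (h2 : ∀ x : R, x + x = 0 → x = 0) (hs : ∀ a : R, (∀ z, a * z * a = 0) → a = 0)
  (d : R →+ R) (hj : ∀ x, d (x * x) = d x * x + x * d x)
  (hc : ∀ x y, (d x * x - x * d x) * y = y * (d x * x - x * d x)) (x : R) : d x * x = x * d x := by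
  obtain ⟨c, hcdef⟩ : ∃ c, c = d x * x - x * d x := ⟨_, rfl⟩
  have cc : ∀ y, c * y = y * c := by intro y; rw [hcdef]; exact hc x y
  have sq : ∀ t : R, (∀ y, t * y = y * t) → t * t = 0 → t = 0 := by
    intro t ht h; apply hs; intro z; rw [ht z, mul_assoc, h, mul_zero]
  have hdx : d x * x = x * d x + c := by rw [hcdef]; abel
  have k1 := hc (x * x) (d x)
  rw [hj x] at k1
  -- [d(x²),x²] = 4 c x²
  have k2 : (d x * x + x * d x) * (x * x) - (x * x) * (d x * x + x * d x) = (4 : ℕ) • (c * x * x) := by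
    have e1 : d x * x * x * x = x * d x * x * x + c * x * x := by rw [hdx]; noncomm_ring
    have e2 : x * (d x * x) * x = x * (x * d x) * x + c * x * x := by rw [hdx, cc x]; rw [mul_add, add_mul]
    have e3 : x * x * (d x * x) = x * x * (x * d x) + c * x * x := by
      rw [hdx, mul_add, mul_assoc c x x, cc (x * x)]
    linear_combination (norm := noncomm_ring) e1 + 2 • e2 + e3
  rw [k2] at k1
  have k3 : c * c * x + c * c * x = 0 := by
    have e1 : c * x * (x * d x) + c * x * c  = c * x * (d x * x) := by rw [hdx, mul_add]
    have e2 : c * (x * d x + c) * x = c * (d x * x) * x := by rw [hdx]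
    have e3 : d x * c  = c * d x := (cc _).symm
    have e5 : d x * (c * x * x) = c * d x * x * x := by rw [← e3]; noncomm_ring
    have e4 : c * x * c = c * c * x := by rw [mul_assoc, ← cc x]; noncomm_ring
    apply h2; apply h2
    linear_combination (norm := noncomm_ring) -k1 + 4 • e1 + 4 • e2 - 4 • e5 - 4 • e4
  have k4 : c * c * x = 0 := h2 _ k3
  have k5 : c * c * c = 0 := by
    have e1 : d x * (c * c * x) = 0 := by rw [k4, mul_zero]
    have e2 : c * c * x * d x = 0 := by rw [k4, zero_mul]
    have e3 : d x * (c * c * x) = c * c * (d x * x) := by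
      rw [← mul_assoc, ← mul_assoc, ← cc, mul_assoc c, ← cc]; noncomm_ring
    rw [e3, hdx] at e1
    linear_combination (norm := noncomm_ring) e1 - e2
  have k6 : c * c = 0 := by
    apply sq
    · intro y; rw [mul_assoc, cc y, ← mul_assoc, cc y, mul_assoc]
    · rw [← mul_assoc, k5, zero_mul]
  have := sq c cc k6
  rw [hdx, this, add_zero]

theorem der_of_jordan (h2 : ∀ x : R, x + x = 0 → x = 0) (hs : ∀ a : R, (∀ z, a * z * a = 0) → a = 0)
  (d : R →+ R) (hj : ∀ x, d (x * x) = d x * x + x * d x) (a b : R) :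
    d (a * b) = d a * b + a * d b := by
  have j : ∀ x y, d (x * y) + d (y * x) = d x * y + x * d y + d y * x + y * d x := by
    intro x y
    have := hj (x + y)
    simp only [add_mul, mul_add, map_add, hj] at this
    linear_combination (norm := noncomm_ring) this
  have t : ∀ a b, d (a * b * a) = d a * b * a + a * d b * a + a * b * d a := by
    intro a b
    rw [← sub_eq_zero]
    apply h2
    have e1 := j a (a * b + b * a)
    have e2 := j (a * a) b
    have e3 := congrArg (fun t => a * t) (j a b)
    have e4 := congrArg (fun t => t * a) (j a b)
    simp only [mul_add, add_mul, map_add, hj, ← mul_assoc] at e1 e2 e3 e4 ⊢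
    linear_combination (norm := noncomm_ring) e1 - e2 + e3 + e4
  have t3 : ∀ a b c, d (a * b * c) + d (c * b * a) = d a * b * c + a * d b * c + a * b * d c
      + d c * b * a + c * d b * a + c * b * d a := by
    intro a b c
    have := t (a + c) b
    simp only [mul_add, add_mul, map_add, t] at this
    linear_combination (norm := noncomm_ring) this
  let δ : R → R → R := fun a b => d (a * b) - d a * b - a * d b
  have hδ : ∀ a b, δ a b = d (a * b) - d a * b - a * d b := fun _ _ => rfl
  have main : ∀ a b c, δ a b * c * (a * b - b * a) + (a * b - b * a) * c * δ a b = 0 := by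
    intro a b c
    have w1 := t3 (a * b) c (b * a)
    have w2 := t a (b * c * b)
    have w3 := t b (a * c * a)
    have w4 := congrArg (fun t => a * t * a) (t b c)
    have w5 := congrArg (fun t => b * t * b) (t a c)
    have w6 := congrArg (fun t => a * b * c * t) (j a b)
    have w7 := congrArg (fun t => t * c * (a * b)) (j a b)
    simp only [hδ, mul_add, add_mul, mul_sub, sub_mul, ← mul_assoc] at w1 w2 w3 w4 w5 w6 w7 ⊢
    linear_combination (norm := noncomm_ring) w1 - w2 - w3 - w4 - w5 + w6 + w7
  have m0 : ∀ a b c, δ a b * c * (a * b - b * a) = 0 := fun a b => sp_anti h2 hs _ _ (main a b)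
  have m1 : ∀ a b x c, δ a b * c * (x * b - b * x) = 0 := fun a b x c =>
    sp_lin hs (fun a => δ a b) (fun a => a * b - b * a)
      (by intro a x; simp only [hδ, add_mul, map_add]; abel)
      (by intro a x; simp only [add_mul, mul_add]; abel) (fun a c => m0 a b c) a x c
  have m2 : ∀ a b c x y, δ a b * c * (x * y - y * x) = 0 := fun a b c x y =>
    sp_lin hs (fun b => δ a b) (fun b => x * b - b * x)
      (by intro a x; simp only [hδ, mul_add, map_add]; abel)
      (by intro a x; simp only [add_mul, mul_add]; abel) (fun b c => m1 a b x c) b y c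
  have cen : ∀ w, δ a b * w = w * δ a b := sp_central hs _ (m2 a b)
  have z0 : ∀ x y, δ a b * (x * y - y * x) = 0 := by
    intro x y
    apply hs
    intro z
    have := congrArg (fun t => t * (x * y - y * x)) (m2 a b ((x * y - y * x) * z * δ a b) x y)
    have := m2 a b ((x * y - y * x) * z * δ a b) x y
    linear_combination (norm := noncomm_ring) this
  obtain ⟨e, he⟩ : ∃ e, e = δ a b := ⟨_, rfl⟩
  have c1 := j (δ a b) (a * b - b * a)
  rw [← cen, z0, ← cen (d (a * b - b * a))] at c1
  rw [← he] at z0 cen c1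
  have c2 : e * e + e * e = e * d (a * b - b * a) := by
    have q1 := congrArg (fun t => e * t) (j a b)
    have q2 := z0 (d a) b
    have q3 := z0 a (d b)
    have q4 : e * e = e * δ a b := by rw [he]
    rw [q4]
    simp only [hδ, map_sub, mul_sub, mul_add] at q1 q2 q3 ⊢
    linear_combination (norm := noncomm_ring) q1 - q2 - q3
  have c3 : e * e * e = 0 := by
    have q1 := congrArg (fun t => e * t) c1
    have q2 : e * (d e * (a * b - b * a)) = 0 := by rw [← mul_assoc, cen, mul_assoc, z0, mul_zero]
    have q3 : e * ((a * b - b * a) * d e) = 0 := by rw [← mul_assoc, z0, zero_mul]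
    have q4 := congrArg (fun t => e * t) c2
    simp only [map_zero, mul_zero, mul_add, q2, q3] at q1 q4
    apply h2; apply h2
    linear_combination (norm := noncomm_ring) -q1 + 2 • q4
  have c4 : e * e = 0 := by
    apply sp_sq hs
    · intro y; rw [mul_assoc, cen y, ← mul_assoc, cen y, mul_assoc]
    · rw [← mul_assoc, c3, zero_mul]
  have c5 := sp_sq hs e cen c4
  rw [he, hδ] at c5
  linear_combination (norm := noncomm_ring) c5

theorem der_central (hs : ∀ a : R, (∀ z, a * z * a = 0) → a = 0)
  (d : R →+ R) (hd : ∀ x y, d (x * y) = d x * y + x * d y) (hc : ∀ x, d x * x = x * d x) (x w : R) :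
    d x * w = w * d x := by
  have l : ∀ x y, d x * y + d y * x = x * d y + y * d x := by
    intro x y
    have := hc (x + y)
    simp only [map_add, add_mul, mul_add, hc] at this
    linear_combination (norm := noncomm_ring) this
  have k : ∀ x y, d x * (x * y - y * x) = 0 := by
    intro x y
    have e1 := l x (x * y)
    have e2 := congrArg (fun t => x * t) (l x y)
    have e3 := congrArg (fun t => t * y) (hc x)
    simp only [hd, mul_add, add_mul] at e1 e2 e3 ⊢
    linear_combination (norm := noncomm_ring) e2 - e1 + 2 • e3
  have k1 : ∀ x c y, d x * c * (x * y - y * x) = 0 := by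
    intro x c y
    have e1 := k x (c * y)
    have e2 := congrArg (fun t => t * y) (k x c)
    simp only [zero_mul] at e2
    linear_combination (norm := noncomm_ring) e1 - e2
  refine sp_central hs _ (fun c a y => ?_) w
  exact sp_lin hs d (fun a => a * y - y * a) (map_add d)
    (by intro a x; simp only [add_mul, mul_add]; abel) (fun a c => k1 a c y) x a c
end alg


theorem unbdd_aux {E : Type*} [NormedAddCommGroup E] [NormedSpace ℂ E] (h : E →ₗ[ℂ] ℂ)
    (hn : ¬ Continuous h) (ε C : ℝ) (hε : 0 < ε) : ∃ b, ‖b‖ ≤ ε ∧ C ≤ ‖h b‖ := by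
  by_contra hcon
  push Not at hcon
  apply hn
  have := LinearMap.bound_of_ball_bound' hε C h (fun z hz => (hcon z (by simpa using hz)).le)
  exact AddMonoidHomClass.continuous_of_bound h _ this

section J
open Filter Topology
variable {A : Type*} [NormedCommRing A] [NormedAlgebra ℂ A] [CompleteSpace A]

theorem chi_cont (χ : A →ₐ[ℂ] ℂ) : Continuous χ := map_continuous χ

/-- bounded case -/
theorem sw_bdd (d : A →ₗ[ℂ] A) (hd : ∀ x y, d (x * y) = d x * y + x * d y) (hc : Continuous d)
    (χ : A →ₐ[ℂ] ℂ) (a : A) : χ (d a) = 0 := by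
  have d1 : d 1 = 0 := by have := hd 1 1; simp at this; exact this
  obtain ⟨a0, ha0⟩ : ∃ a0, a0 = a - algebraMap ℂ A (χ a) := ⟨_, rfl⟩
  have hχ0 : χ a0 = 0 := by rw [ha0]; simp
  have hda0 : d a0 = d a := by
    rw [ha0, map_sub, Algebra.algebraMap_eq_smul_one, map_smul, d1]; simp
  have dpow : ∀ n : ℕ, d (a0 ^ (n + 1)) = (n + 1 : ℂ) • (a0 ^ n * d a0) := by
    intro n
    induction n with
    | zero => simp
    | succ n ih =>
      rw [pow_succ, hd, ih]; push_cast
      simp only [Algebra.smul_def, map_add, map_natCast, map_one]; ring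
  have key : ∀ k : ℕ, (∀ x, χ ((d ^ k) (a0 ^ k * x)) = (k.factorial : ℂ) * χ (d a) ^ k * χ x) ∧
      ∀ n, k < n → ∀ x, χ ((d ^ k) (a0 ^ n * x)) = 0 := by
    intro k
    induction k with
    | zero =>
      refine ⟨by simp, fun n hn x => ?_⟩
      simp [hχ0, hn.ne']
    | succ k ih =>
      have step : ∀ (n : ℕ) (x : A), (d ^ (k + 1)) (a0 ^ (n + 1) * x) =
          (n + 1 : ℂ) • (d ^ k) (a0 ^ n * (d a * x)) + (d ^ k) (a0 ^ (n + 1) * d x) := by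
        intro n x
        rw [pow_succ d, Module.End.mul_apply, hd, dpow, hda0, map_add, smul_mul_assoc, map_smul,
          mul_assoc]
      constructor
      · intro x
        rw [step, map_add, map_smul, ih.1, ih.2 _ (Nat.lt_succ_self k), Nat.factorial_succ, map_mul]
        push_cast
        simp only [smul_eq_mul]; ring
      · intro n hn x
        obtain ⟨m, rfl⟩ : ∃ m, n = m + 1 := ⟨n - 1, by omega⟩
        rw [step, map_add, map_smul, ih.2 _ (by omega), ih.2 _ (by omega)]; simp
  let D : A →L[ℂ] A := ⟨d, hc⟩
  let X : A →L[ℂ] ℂ := ⟨χ.toLinearMap, chi_cont χ⟩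
  have bd : ∀ n : ℕ, n.factorial * ‖χ (d a)‖ ^ n ≤ ‖X‖ * ‖(1 : A)‖ * (‖D‖ * ‖a0‖) ^ n := by
    intro n
    have e := (key n).1 1
    have h1 : ∀ x, ‖(d ^ n) x‖ ≤ ‖D‖ ^ n * ‖x‖ := by
      intro x
      clear e
      induction n with
      | zero => simp
      | succ n ih =>
        rw [pow_succ', Module.End.mul_apply, pow_succ', mul_assoc]
        exact (D.le_opNorm _).trans (mul_le_mul_of_nonneg_left ih (norm_nonneg _))
    have h2 : ‖a0 ^ n * 1‖ ≤ ‖a0‖ ^ n * ‖(1 : A)‖ := by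
      clear e h1
      induction n with
      | zero => simp
      | succ n ih =>
        rw [pow_succ', pow_succ', mul_assoc, mul_assoc]
        exact (norm_mul_le _ _).trans (mul_le_mul_of_nonneg_left ih (norm_nonneg _))
    have h3 : ‖χ ((d ^ n) (a0 ^ n * 1))‖ ≤ ‖X‖ * ‖(d ^ n) (a0 ^ n * 1)‖ := X.le_opNorm _
    rw [e] at h3
    simp only [map_one, mul_one, norm_mul, norm_pow, Complex.norm_natCast] at h3
    refine h3.trans ?_
    rw [mul_assoc]
    gcongr
    calc _ ≤ _ := h1 _
      _ ≤ ‖D‖ ^ n * (‖a0‖ ^ n * ‖(1 : A)‖) := by rw [mul_one] at h2; gcongr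
      _ = _ := by ring
  by_contra hne
  have hpos : 0 < ‖χ (d a)‖ := norm_pos_iff.mpr hne
  have lim := (FloorSemiring.tendsto_pow_div_factorial_atTop ((‖D‖ * ‖a0‖) / ‖χ (d a)‖)).const_mul (‖X‖ * ‖(1 : A)‖)
  have : (1 : ℝ) ≤ ‖X‖ * ‖(1 : A)‖ * 0 := by
    refine ge_of_tendsto' lim fun n => ?_
    have := bd n
    have hf : (0 : ℝ) < n.factorial := by positivity
    rw [div_pow, div_div, ← mul_div_assoc, le_div_iff₀ (by positivity)]
    linarith
  norm_num at this

theorem sep_aux (V : Set (A →ₐ[ℂ] ℂ)) (hV : V.Infinite) :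
    ∃ χ ∈ V, ∃ g : A, ‖g‖ ≤ 1 ∧ χ g = 0 ∧ {ψ ∈ V | ψ g ≠ 0}.Infinite := by
  obtain ⟨χ₁, h₁, χ₂, h₂, hne⟩ := hV.nontrivial
  obtain ⟨a, ha⟩ : ∃ a, χ₁ a ≠ χ₂ a := by
    by_contra h; push Not at h; exact hne (AlgHom.ext h)
  have key : ∀ χ ∈ V, {ψ ∈ V | ψ (a - algebraMap ℂ A (χ a)) ≠ 0}.Infinite →
    ∃ χ ∈ V, ∃ g : A, ‖g‖ ≤ 1 ∧ χ g = 0 ∧ {ψ ∈ V | ψ g ≠ 0}.Infinite := by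
    intro χ hχ hinf
    obtain ⟨g, hg⟩ : ∃ g, g = a - algebraMap ℂ A (χ a) := ⟨_, rfl⟩
    rw [← hg] at hinf
    have hpos : 0 < 1 + ‖g‖ := by positivity
    refine ⟨χ, hχ, ((1 + ‖g‖ : ℝ) : ℂ)⁻¹ • g, ?_, ?_, ?_⟩
    · rw [norm_smul, norm_inv, Complex.norm_real, Real.norm_of_nonneg hpos.le, inv_mul_le_iff₀ hpos]
      linarith
    · rw [map_smul, hg]; simp
    · convert hinf using 4 with ψ
      rw [map_smul, smul_eq_mul, mul_ne_zero_iff]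
      simp only [ne_eq, inv_eq_zero, Complex.ofReal_eq_zero, hpos.ne', not_false_eq_true, true_and]
  by_contra hcon
  have f1 : {ψ ∈ V | ψ (a - algebraMap ℂ A (χ₁ a)) ≠ 0}.Finite := by
    by_contra h; exact hcon (key χ₁ h₁ h)
  have f2 : {ψ ∈ V | ψ (a - algebraMap ℂ A (χ₂ a)) ≠ 0}.Finite := by
    by_contra h; exact hcon (key χ₂ h₂ h)
  apply hV
  refine (f1.union f2).subset ?_
  intro ψ hψ
  by_contra h
  simp [hψ, sub_eq_zero] at h
  exact ha (h.1.symm.trans h.2)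

theorem fin_disc (d : A →ₗ[ℂ] A) (hd : ∀ x y, d (x * y) = d x * y + x * d y) :
    {χ : A →ₐ[ℂ] ℂ | ¬ Continuous (fun a => χ (d a))}.Finite := by
  by_contra hinf
  change Set.Infinite _ at hinf
  obtain ⟨U, hU⟩ : ∃ U, U = {χ : A →ₐ[ℂ] ℂ | ¬ Continuous (fun a => χ (d a))} := ⟨_, rfl⟩
  rw [← hU] at hinf
  haveI : Nonempty (A →ₐ[ℂ] ℂ) := ⟨hinf.nonempty.some⟩
  choose! X hXV G hG1 hXG hGinf using (sep_aux (A := A))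
  let V : ℕ → Set (A →ₐ[ℂ] ℂ) := fun n => Nat.rec U (fun _ W => {ψ ∈ W | ψ (G W) ≠ 0}) n
  have V0 : V 0 = U := rfl
  have VS : ∀ n, V (n + 1) = {ψ ∈ V n | ψ (G (V n)) ≠ 0} := fun n => rfl
  have Vinf : ∀ n, (V n).Infinite := by
    intro n
    induction n with
    | zero => exact hinf
    | succ n ih => rw [VS]; exact hGinf _ ih
  have Vanti : Antitone V := antitone_nat_of_succ_le fun n => by rw [VS]; exact Set.sep_subset _ _
  obtain ⟨χ, hχ⟩ : ∃ χ : ℕ → (A →ₐ[ℂ] ℂ), ∀ n, χ n = X (V n) := ⟨_, fun _ => rfl⟩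
  obtain ⟨g, hg⟩ : ∃ g : ℕ → A, ∀ n, g n = G (V n) := ⟨_, fun _ => rfl⟩
  have hχV : ∀ n, χ n ∈ V n := fun n => by rw [hχ]; exact hXV _ (Vinf n)
  have hχU : ∀ n, ¬ Continuous (fun a => χ n (d a)) := by
    intro n
    have := Vanti (Nat.zero_le n) (hχV n)
    rw [V0, hU] at this; exact this
  have hg1 : ∀ n, ‖g n‖ ≤ 1 := fun n => by rw [hg]; exact hG1 _ (Vinf n)
  have hχg : ∀ n, χ n (g n) = 0 := fun n => by rw [hχ, hg]; exact hXG _ (Vinf n)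
  have hχg' : ∀ m n, n < m → χ m (g n) ≠ 0 := by
    intro m n h
    have := Vanti (Nat.succ_le_of_lt h) (hχV m)
    rw [Nat.succ_eq_add_one, VS] at this
    rw [hg]; exact this.2
  -- contraction
  have hcontr : ∀ (s : Finset ℕ) x, ‖(∏ i ∈ s, g i) * x‖ ≤ ‖x‖ := by
    intro s
    induction s using Finset.induction_on with
    | empty => simp
    | insert i s hi ih =>
      intro x
      rw [Finset.prod_insert hi, mul_assoc]
      calc _ ≤ ‖g i‖ * ‖(∏ i ∈ s, g i) * x‖ := norm_mul_le _ _
        _ ≤ 1 * ‖x‖ := mul_le_mul (hg1 i) (ih x) (norm_nonneg _) zero_le_one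
        _ = _ := one_mul _
  obtain ⟨P, hP⟩ : ∃ P : ℕ → A, ∀ n, P n = ∏ i ∈ Finset.range n, g i := ⟨_, fun _ => rfl⟩
  have ex : ∀ (n : ℕ) (s : A), ∃ b : A, ‖b‖ ≤ (1 / 2 : ℝ) ^ n ∧
      n + ‖χ n (d s)‖ ≤ ‖χ n (d (P n ^ 2 * b))‖ := by
    intro n s
    let h : A →ₗ[ℂ] ℂ := (χ n).toLinearMap ∘ₗ d ∘ₗ LinearMap.mulLeft ℂ (P n ^ 2)
    refine unbdd_aux h ?_ _ _ (by positivity)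
    intro hc
    apply hχU n
    have hne : χ n (P n ^ 2) ≠ 0 := by
      rw [map_pow, hP, map_prod]
      exact pow_ne_zero _ (Finset.prod_ne_zero_iff.mpr fun i hi => hχg' n i (Finset.mem_range.mp hi))
    have : (fun a => χ n (d a)) = fun a => (χ n (P n ^ 2))⁻¹ * (h a - χ n (d (P n ^ 2)) * χ n a) := by
      funext a
      have : h a = χ n (d (P n ^ 2)) * χ n a + χ n (P n ^ 2) * χ n (d a) := by
        change χ n (d (P n ^ 2 * a)) = _
        rw [hd, map_add, map_mul, map_mul]
      rw [this]; field_simp; ring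
    rw [this]
    exact continuous_const.mul (hc.sub (continuous_const.mul (chi_cont (χ n))))
  choose b hb1 hb2 using ex
  let s : ℕ → A := fun n => Nat.rec 0 (fun k t => t + P k ^ 2 * b k t) n
  have s0 : s 0 = 0 := rfl
  have sS : ∀ n, s (n + 1) = s n + P n ^ 2 * b n (s n) := fun n => rfl
  obtain ⟨c, hc⟩ : ∃ c : ℕ → A, ∀ n, c n = b n (s n) := ⟨_, fun _ => rfl⟩
  have ssum : ∀ n, s n = ∑ k ∈ Finset.range n, P k ^ 2 * c k := by
    intro n
    induction n with
    | zero => simp [s0]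
    | succ n ih => rw [sS, Finset.sum_range_succ, ← ih, hc]
  have hcn : ∀ n, ‖c n‖ ≤ (1 / 2 : ℝ) ^ n := fun n => by rw [hc]; exact hb1 _ _
  have sg : Summable fun n : ℕ => (1 / 2 : ℝ) ^ n := summable_geometric_two
  have hsm : Summable fun k => P k ^ 2 * c k := by
    refine Summable.of_norm_bounded sg fun k => ?_
    rw [pow_two, mul_assoc, hP]
    exact ((hcontr _ _).trans (hcontr _ _)).trans (hcn k)
  obtain ⟨a, ha⟩ : ∃ a, a = ∑' k, P k ^ 2 * c k := ⟨_, rfl⟩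
  have big : ∀ n : ℕ, (n : ℝ) ≤ ‖χ n (d a)‖ := by
    intro n
    let Q : ℕ → A := fun k => ∏ i ∈ (Finset.range (k + (n + 1))).erase n, g i
    have hQ : ∀ k, P (k + (n + 1)) = g n * Q k := by
      intro k
      rw [hP]; exact (Finset.mul_prod_erase _ _ (by simp; omega)).symm
    have hsm2 : Summable fun k => Q k ^ 2 * c (k + (n + 1)) := by
      refine Summable.of_norm_bounded ((summable_nat_add_iff (n + 1)).mpr sg) fun k => ?_
      rw [pow_two, mul_assoc]
      exact ((hcontr _ _).trans (hcontr _ _)).trans (hcn _)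
    have tail : ∑' k, P (k + (n + 1)) ^ 2 * c (k + (n + 1)) =
        g n * (g n * ∑' k, Q k ^ 2 * c (k + (n + 1))) := by
      rw [← mul_assoc, ← hsm2.tsum_mul_left]
      congr 1; funext k; rw [hQ]; ring
    have e : a = s n + P n ^ 2 * b n (s n) + g n * (g n * ∑' k, Q k ^ 2 * c (k + (n + 1))) := by
      rw [ha, ← hsm.sum_add_tsum_nat_add (n + 1), tail, ← ssum, sS]
    have e2 : χ n (d a) = χ n (d (s n)) + χ n (d (P n ^ 2 * b n (s n))) := by
      have e3 : χ n (d (g n * (g n * ∑' k, Q k ^ 2 * c (k + (n + 1))))) = 0 := by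
        rw [hd (g n), map_add, map_mul, map_mul, map_mul, hχg]
        simp
      rw [e, map_add, map_add, map_add, map_add, e3, add_zero]
    have h1 := hb2 n (s n)
    have h2 := norm_sub_le (χ n (d a)) (χ n (d (s n)))
    rw [e2, add_sub_cancel_left, ← e2] at h2
    linarith
  -- bounded
  obtain ⟨n, hn⟩ := exists_nat_gt (‖d a‖ * ‖(1 : A)‖)
  have := AlgHom.norm_apply_le_self_mul_norm_one (χ n) (d a)
  linarith [big n]

theorem johnson (hss : ∀ a : A, (∀ χ : A →ₐ[ℂ] ℂ, χ a = 0) → a = 0)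
    (d : A →ₗ[ℂ] A) (hd : ∀ x y, d (x * y) = d x * y + x * d y) (a : A) : d a = 0 := by
  have hfin := fin_disc d hd
  have hall : ∀ χ : A →ₐ[ℂ] ℂ, Continuous (fun a => χ (d a)) := by
    intro χ
    by_contra hχ
    obtain ⟨g, hg1, hg0⟩ : ∃ g : A, χ g = 1 ∧
        ∀ ψ : A →ₐ[ℂ] ℂ, ¬ Continuous (fun a => ψ (d a)) → ψ ≠ χ → ψ g = 0 := by
      have : ∀ ψ : A →ₐ[ℂ] ℂ, ∃ g : A, χ g = 1 ∧ (ψ ≠ χ → ψ g = 0) := by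
        intro ψ
        by_cases h : ψ = χ
        · exact ⟨1, map_one _, fun h' => absurd h h'⟩
        · obtain ⟨a, ha⟩ : ∃ a, χ a ≠ ψ a := by
            by_contra h'; push Not at h'; exact h (AlgHom.ext h').symm
          refine ⟨(χ a - ψ a)⁻¹ • (a - algebraMap ℂ A (ψ a)), ?_, fun _ => ?_⟩
          · rw [map_smul, map_sub, AlgHom.commutes]
            exact inv_mul_cancel₀ (sub_ne_zero.mpr ha)
          · rw [map_smul, map_sub, AlgHom.commutes]; simp
      choose G hG1 hG0 using this
      refine ⟨∏ ψ ∈ hfin.toFinset, G ψ, ?_, ?_⟩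
      · rw [map_prod]; exact Finset.prod_eq_one fun ψ _ => hG1 ψ
      · intro ψ h1 h2
        rw [map_prod]
        exact Finset.prod_eq_zero (i := ψ) (by simpa using h1) (hG0 ψ h2)
    let T : A →ₗ[ℂ] A := LinearMap.mulLeft ℂ g ∘ₗ d
    have hT : ∀ x, T x = g * d x := fun _ => rfl
    have hTn : ¬ Continuous T := by
      intro h
      apply hχ
      have : (fun a => χ (d a)) = fun a => χ (T a) := by
        funext a; rw [hT, map_mul, hg1, one_mul]
      rw [this]; exact (chi_cont χ).comp h
    obtain ⟨s, hs0, hsψ⟩ : ∃ s : A, s ≠ 0 ∧ ∀ ψ : A →ₐ[ℂ] ℂ, ψ ≠ χ → ψ s = 0 := by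
      by_contra hcon
      apply hTn
      refine T.continuous_of_seq_closed_graph fun v x y hv hTv => ?_
      by_contra hne
      apply hcon
      refine ⟨y - T x, sub_ne_zero.mpr hne, fun ψ hψ => ?_⟩
      rw [map_sub, sub_eq_zero]
      have c : Continuous fun x => ψ (T x) := by
        by_cases h : Continuous (fun a => ψ (d a))
        · simp only [hT, map_mul]; exact continuous_const.mul h
        · simp only [hT, map_mul, hg0 ψ h hψ, zero_mul]; exact continuous_const
      exact tendsto_nhds_unique (((chi_cont ψ).tendsto y).comp hTv) ((c.tendsto x).comp hv)
    have hχs : χ s ≠ 0 := by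
      intro h
      apply hs0
      apply hss
      intro ψ
      by_cases h' : ψ = χ
      · rw [h', h]
      · exact hsψ ψ h'
    have hsa : ∀ a, s * a = χ a • s := by
      intro a
      rw [← sub_eq_zero]
      apply hss
      intro ψ
      rw [map_sub, map_mul, map_smul, smul_eq_mul]
      by_cases h' : ψ = χ
      · rw [h']; ring
      · rw [hsψ ψ h']; ring
    have hds : χ (d s) = 0 := by
      have := congrArg (fun t => χ (d t)) (hsa s)
      simp only [hd, map_add, map_mul, map_smul, smul_eq_mul] at this
      have h : χ s * χ (d s) = 0 := by linear_combination this
      exact (mul_eq_zero.mp h).resolve_left hχs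
    apply hχ
    have : (fun a => χ (d a)) = fun _ => 0 := by
      funext a
      have := congrArg (fun t => χ (d t)) (hsa a)
      simp only [hd, map_add, map_mul, map_smul, smul_eq_mul, hds] at this
      have h : χ s * χ (d a) = 0 := by linear_combination this
      exact (mul_eq_zero.mp h).resolve_left hχs
    rw [this]; exact continuous_const
  have hcd : Continuous d := by
    refine d.continuous_of_seq_closed_graph fun v x y hv hTv => ?_
    rw [← sub_eq_zero]
    apply hss
    intro ψ
    rw [map_sub, sub_eq_zero]
    exact tendsto_nhds_unique (((chi_cont ψ).tendsto y).comp hTv) (((hall ψ).tendsto x).comp hv)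
  exact hss _ fun χ => sw_bdd d hd hcd χ a
end J

section C
open Filter Topology
variable {B : Type*} [NonUnitalNormedRing B] [NormedSpace ℂ B] [IsScalarTower ℂ B B]
  [SMulCommClass ℂ B B] [CompleteSpace B]

abbrev Bp (B : Type*) [NonUnitalNormedRing B] [NormedSpace ℂ B] := WithLp 1 (Unitization ℂ B)

def bmk (c : ℂ) (b : B) : Bp B := WithLp.toLp 1 (Unitization.inl c + Unitization.inr b)
def bfst (x : Bp B) : ℂ := (WithLp.ofLp x).fst
def bsnd (x : Bp B) : B := (WithLp.ofLp x).snd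

theorem bext {x y : Bp B} (h1 : bfst x = bfst y) (h2 : bsnd x = bsnd y) : x = y := by
  apply (WithLp.equiv 1 (Unitization ℂ B)).injective
  exact Unitization.ext h1 h2

@[simp] theorem bfst_mk (c : ℂ) (b : B) : bfst (bmk c b) = c := by simp [bfst, bmk]
@[simp] theorem bsnd_mk (c : ℂ) (b : B) : bsnd (bmk c b) = b := by simp [bsnd, bmk]
@[simp] theorem bfst_add (x y : Bp B) : bfst (x + y) = bfst x + bfst y := rfl
@[simp] theorem bsnd_add (x y : Bp B) : bsnd (x + y) = bsnd x + bsnd y := rfl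
@[simp] theorem bfst_sub (x y : Bp B) : bfst (x - y) = bfst x - bfst y := rfl
@[simp] theorem bsnd_sub (x y : Bp B) : bsnd (x - y) = bsnd x - bsnd y := rfl
@[simp] theorem bfst_smul (c : ℂ) (y : Bp B) : bfst (c • y) = c * bfst y := rfl
@[simp] theorem bsnd_smul (c : ℂ) (y : Bp B) : bsnd (c • y) = c • bsnd y := rfl
@[simp] theorem bfst_mul (x y : Bp B) : bfst (x * y) = bfst x * bfst y := rfl
@[simp] theorem bsnd_mul (x y : Bp B) :
    bsnd (x * y) = bfst x • bsnd y + bfst y • bsnd x + bsnd x * bsnd y := rfl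
@[simp] theorem bfst_one : bfst (1 : Bp B) = 1 := rfl
@[simp] theorem bsnd_one : bsnd (1 : Bp B) = 0 := rfl
@[simp] theorem bfst_zero : bfst (0 : Bp B) = 0 := rfl
@[simp] theorem bsnd_zero : bsnd (0 : Bp B) = 0 := rfl

theorem bmem_center {x : Bp B} :
    x ∈ Subalgebra.center ℂ (Bp B) ↔ ∀ y : B, bsnd x * y = y * bsnd x := by
  rw [Subalgebra.mem_center_iff]
  constructor
  · intro h y
    have := congrArg bsnd (h (bmk 0 y))
    simp at this
    exact this.symm
  · intro h y
    apply bext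
    · simp [mul_comm]
    · simp [h]; abel

theorem bnorm_one : ‖(1 : Bp B)‖ = 1 := by
  rw [WithLp.unitization_norm_def]
  change ‖bfst (1 : Bp B)‖ + ‖bsnd (1 : Bp B)‖ = 1
  simp

theorem qn_unit (q z : Bp B) (hqz : Commute q z)
    (h : ∀ ε : ℝ, 0 < ε → ∃ n, n ≠ 0 ∧ ‖z ^ n‖ ≤ ε ^ n) : IsUnit (1 - q * z) := by
  by_contra hcon
  have h1 : (1 : ℂ) ∈ spectrum ℂ (q * z) := by
    rw [spectrum.mem_iff, map_one]; exact hcon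
  obtain ⟨n, hn, hz⟩ := h (2 * (‖q‖ + 1))⁻¹ (by positivity)
  have h2 := spectrum.norm_le_norm_mul_of_mem (spectrum.pow_mem_pow (q * z) n h1)
  rw [one_pow, norm_one, bnorm_one, mul_one, hqz.mul_pow] at h2
  have h3 : ‖q ^ n * z ^ n‖ ≤ (‖q‖ * (2 * (‖q‖ + 1))⁻¹) ^ n := by
    rw [mul_pow]
    refine (norm_mul_le _ _).trans ?_
    exact mul_le_mul (norm_pow_le' _ (Nat.pos_of_ne_zero hn)) hz (norm_nonneg _) (by positivity)
  have h4 : ‖q‖ * (2 * (‖q‖ + 1))⁻¹ < 1 := by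
    rw [← div_eq_mul_inv, div_lt_one (by positivity)]
    linarith [norm_nonneg q]
  have := pow_lt_one₀ (by positivity) h4 hn
  linarith

theorem qn_of_char {A : Type*} [NormedCommRing A] [NormedAlgebra ℂ A] [CompleteSpace A] (z : A)
    (hz : ∀ χ : A →ₐ[ℂ] ℂ, χ z = 0) (ε : ℝ) (hε : 0 < ε) : ∃ n, n ≠ 0 ∧ ‖z ^ n‖ ≤ ε ^ n := by
  have hs : spectralRadius ℂ z = 0 := by
    rw [spectralRadius]
    simp only [ENNReal.iSup_eq_zero]
    intro k hk
    obtain ⟨f, hf⟩ := WeakDual.CharacterSpace.mem_spectrum_iff_exists.mp hk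
    have := hz (WeakDual.CharacterSpace.equivAlgHom f)
    have h0 : k = 0 := by rw [← hf]; exact this
    simp [h0]
  have lim := spectrum.pow_nnnorm_pow_one_div_tendsto_nhds_spectralRadius z
  rw [hs] at lim
  have ev := (lim.eventually_lt_const (u := ENNReal.ofReal ε) (by simpa using hε)).and
    (eventually_ge_atTop 1)
  obtain ⟨n, hn, hn1⟩ := ev.exists
  refine ⟨n, by omega, ?_⟩
  have hn0 : (n : ℝ) ≠ 0 := by positivity
  have h2 := pow_le_pow_left₀ (by simp) hn.le n
  rw [← ENNReal.rpow_natCast, ← ENNReal.rpow_mul, one_div, inv_mul_cancel₀ hn0, ENNReal.rpow_one,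
    ← ENNReal.ofReal_pow hε.le] at h2
  have h3 : ENNReal.ofReal ‖z ^ n‖ ≤ ENNReal.ofReal (ε ^ n) := by
    rw [ofReal_norm]; exact h2
  exact (ENNReal.ofReal_le_ofReal_iff (by positivity)).mp h3

theorem der_center_zero
    (hss : ∀ z : B,
      (∀ (c : ℂ) (b : B), ∃ y : B, y + (c • z + b * z) = y * (c • z + b * z)) → z = 0)
    (d : B →ₗ[ℂ] B) (hd : ∀ x y, d (x * y) = d x * y + x * d y)
    (hc : ∀ x w, d x * w = w * d x) (b : B) (hb : ∀ y, b * y = y * b) : d b = 0 := by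
  letI : NormedCommRing (Subalgebra.center ℂ (Bp B)) :=
    { (inferInstance : NormedRing (Subalgebra.center ℂ (Bp B))) with
      mul_comm := fun x y => Subtype.ext ((Subalgebra.mem_center_iff.mp y.2) x.1) }
  haveI : CompleteSpace (Subalgebra.center ℂ (Bp B)) := by
    have : IsClosed ((Subalgebra.center ℂ (Bp B) : Set (Bp B))) := by
      change IsClosed (Set.center (Bp B))
      have e : Set.center (Bp B) = ⋂ y : Bp B, {x | y * x = x * y} := by
        ext x; simp [Semigroup.mem_center_iff]
      rw [e]
      exact isClosed_iInter fun y =>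
        isClosed_eq (continuous_const.mul continuous_id) (continuous_id.mul continuous_const)
    exact this.completeSpace_coe
  letI : NormedAlgebra ℂ (Subalgebra.center ℂ (Bp B)) := Subalgebra.toNormedAlgebra _
  let D : Subalgebra.center ℂ (Bp B) →ₗ[ℂ] Subalgebra.center ℂ (Bp B) :=
    { toFun := fun x => ⟨bmk 0 (d (bsnd x.1)), bmem_center.mpr (by simpa using hc _)⟩
      map_add' := by
        intro x y; apply Subtype.ext; apply bext <;> simp
      map_smul' := by
        intro c y; apply Subtype.ext; apply bext <;> simp }
  have hD : ∀ x, (D x).1 = bmk 0 (d (bsnd x.1)) := fun _ => rfl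
  have hDer : ∀ x y, D (x * y) = D x * y + x * D y := by
    intro x y
    apply Subtype.ext
    change (D (x * y)).1 = (D x).1 * y.1 + x.1 * (D y).1
    rw [hD, hD, hD]
    change bmk 0 (d (bsnd (x.1 * y.1))) = _
    apply bext
    · simp
    · simp [hd]; abel
  have hS : ∀ a : Subalgebra.center ℂ (Bp B),
      (∀ χ : Subalgebra.center ℂ (Bp B) →ₐ[ℂ] ℂ, χ a = 0) → a = 0 := by
    intro a ha
    have hq := qn_of_char a ha
    have hf : bfst a.1 = 0 := by
      obtain ⟨F, hF⟩ : ∃ F : Subalgebra.center ℂ (Bp B) →ₐ[ℂ] ℂ, ∀ x, F x = bfst x.1 :=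
        ⟨{ toFun := fun x => bfst x.1
           map_one' := rfl
           map_mul' := fun _ _ => rfl
           map_zero' := rfl
           map_add' := fun _ _ => rfl
           commutes' := fun r => by
             change bfst (algebraMap ℂ (Bp B) r) = r
             rw [Algebra.algebraMap_eq_smul_one]; simp }, fun _ => rfl⟩
      rw [← hF]; exact ha F
    have hs0 : bsnd a.1 = 0 := by
      apply hss
      intro c x
      have hu := qn_unit (bmk c x) a.1 (Subalgebra.mem_center_iff.mp a.2 _) (fun ε hε => by
        obtain ⟨n, h1, h2⟩ := hq ε hε
        exact ⟨n, h1, h2⟩)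
      obtain ⟨v, hv⟩ := hu.exists_left_inv
      have e1 := congrArg bfst hv
      have e2 := congrArg bsnd hv
      simp [hf] at e1 e2
      rw [e1] at e2
      refine ⟨-bsnd v, ?_⟩
      simp only [one_smul, mul_neg, mul_add, neg_mul, mul_smul_comm] at e2 ⊢
      linear_combination (norm := module) -e2
    apply Subtype.ext
    apply bext
    · rw [hf]; rfl
    · rw [hs0]; rfl
  have := johnson hS D hDer ⟨bmk 0 b, bmem_center.mpr (by simpa using hb)⟩
  have h2 := congrArg (fun t => bsnd t.1) this
  simp only [hD] at h2
  simpa using h2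

theorem B_part
    (hss : ∀ z : B,
      (∀ (c : ℂ) (b : B), ∃ y : B, y + (c • z + b * z) = y * (c • z + b * z)) → z = 0)
    (d : B →ₗ[ℂ] B) (hj : ∀ x, d (x * x) = d x * x + x * d x)
    (hc : ∀ x y, (d x * x - x * d x) * y = y * (d x * x - x * d x)) (b : B) : d b = 0 := by
  have h2 : ∀ x : B, x + x = 0 → x = 0 := by
    intro x hx
    rw [← two_smul ℂ] at hx
    exact (smul_eq_zero.mp hx).resolve_left two_ne_zero
  have hs : ∀ a : B, (∀ z, a * z * a = 0) → a = 0 := by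
    intro a ha
    apply hss
    intro c x
    have h3 : (c • a + x * a) * (c • a + x * a) * (c • a + x * a) = 0 := by
      have e1 : a * (a * a) = 0 := by rw [← mul_assoc]; exact ha a
      have e2 : a * (x * a) = 0 := by rw [← mul_assoc]; exact ha x
      have e3 : a * (a * (x * a)) = 0 := by rw [e2, mul_zero]
      have e4 : a * (x * (a * a)) = 0 := by
        have := congrArg (· * a) e2
        simpa [mul_assoc] using this
      simp [mul_add, add_mul, mul_assoc, smul_mul_assoc, mul_smul_comm, e1, e2]
    refine ⟨-(c • a + x * a) - (c • a + x * a) * (c • a + x * a), ?_⟩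
    rw [sub_mul, neg_mul, h3]; abel
  have comm := comm_of_centr h2 hs d.toAddMonoidHom hj hc
  have der := der_of_jordan h2 hs d.toAddMonoidHom hj
  have cen := der_central hs d.toAddMonoidHom der comm
  simp only [LinearMap.toAddMonoidHom_coe] at comm der cen
  have dd : ∀ x, d (d x) = 0 := fun x => der_center_zero hss d der cen _ (cen x)
  apply sp_sq hs _ (cen b)
  apply h2
  have := dd (b * b)
  rw [der, map_add, der, der, dd] at this
  simpa using this
end C

/-- Theorem 2.6: if `B` is semisimple and `θ ≠ φ`, then the only `(η₁,η₂)`-centralizing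
element of `Der_J(A ×_θ^{φ,γ} B)` is the zero map. -/
theorem lau_jordan_centralizing_eq_zero
    {A B : Type*}
    [NonUnitalNormedRing A] [NormedSpace ℂ A] [IsScalarTower ℂ A A] [SMulCommClass ℂ A A]
    [CompleteSpace A]
    [NonUnitalNormedRing B] [NormedSpace ℂ B] [IsScalarTower ℂ B B] [SMulCommClass ℂ B B]
    [CompleteSpace B]
    (u : A) (hu : ∀ a : A, a * u = a)
    (hss : ∀ z : B,
      (∀ (c : ℂ) (b : B), ∃ y : B, y + (c • z + b * z) = y * (c • z + b * z)) → z = 0)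
    (θ φ γ : B →ₗ[ℂ] ℂ)
    (hθmul : ∀ x y : B, θ (x * y) = θ x * θ y) (hθ0 : θ ≠ 0)
    (hφmul : ∀ x y : B, φ (x * y) = φ x * φ y) (hφ0 : φ ≠ 0)
    (hγmul : ∀ x y : B, γ (x * y) = γ x * γ y) (hγ0 : γ ≠ 0)
    (η₁ η₂ : B →ₗ[ℂ] ℂ)
    (hη₁mul : ∀ x y : B, η₁ (x * y) = η₁ x * η₁ y) (hη₁0 : η₁ ≠ 0)
    (hη₂mul : ∀ x y : B, η₂ (x * y) = η₂ x * η₂ y) (hη₂0 : η₂ ≠ 0)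
    (hθφ : θ ≠ φ)
    (d : A × B →ₗ[ℂ] A × B)
    (hd : ∀ (a : A) (b : B),
      d (lauMul θ (a, b) (a, b)) = lauMul φ (d (a, b)) (a, b) + lauMul γ (a, b) (d (a, b)))
    (hcen : ∀ (a : A) (b : B),
      (lauMul η₁ (d (a, b)) (a, b) - lauMul η₂ (a, b) (d (a, b))).1 ∈ Set.center A ∧
      (lauMul η₁ (d (a, b)) (a, b) - lauMul η₂ (a, b) (d (a, b))).2 ∈ Set.center B) :
    d = 0 := by
  have h2A : ∀ x : A, x + x = 0 → x = 0 := by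
    intro x hx
    rw [← two_smul ℂ] at hx
    exact (smul_eq_zero.mp hx).resolve_left two_ne_zero
  have e0 : ∀ (a : A) (b : B), d (a, b) = d (a, 0) + d (0, b) := by
    intro a b; rw [← map_add]; simp
  obtain ⟨d1, hd1⟩ : ∃ d1 : A →ₗ[ℂ] A, ∀ a, d1 a = (d (a, 0)).1 :=
    ⟨LinearMap.fst ℂ A B ∘ₗ d ∘ₗ LinearMap.inl ℂ A B, fun _ => rfl⟩
  obtain ⟨d2, hd2⟩ : ∃ d2 : B →ₗ[ℂ] A, ∀ b, d2 b = (d (0, b)).1 :=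
    ⟨LinearMap.fst ℂ A B ∘ₗ d ∘ₗ LinearMap.inr ℂ A B, fun _ => rfl⟩
  obtain ⟨d3, hd3⟩ : ∃ d3 : A →ₗ[ℂ] B, ∀ a, d3 a = (d (a, 0)).2 :=
    ⟨LinearMap.snd ℂ A B ∘ₗ d ∘ₗ LinearMap.inl ℂ A B, fun _ => rfl⟩
  obtain ⟨d4, hd4⟩ : ∃ d4 : B →ₗ[ℂ] B, ∀ b, d4 b = (d (0, b)).2 :=
    ⟨LinearMap.snd ℂ A B ∘ₗ d ∘ₗ LinearMap.inr ℂ A B, fun _ => rfl⟩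
  have hdd : ∀ a b, d (a, b) = (d1 a + d2 b, d3 a + d4 b) := by
    intro a b
    rw [e0, hd1, hd2, hd3, hd4]; rfl
  simp only [lauMul, hdd, Prod.mk_add_mk, Prod.mk.injEq, Prod.mk_sub_mk] at hd hcen
  -- the third block vanishes
  have h3sq : ∀ a, d3 (a * a) = 0 := by
    intro a
    have := (hd a 0).2
    simpa using this
  have h3l : ∀ a b, d3 (a * b) + d3 (b * a) = 0 := by
    intro a b
    have := h3sq (a + b)
    simp only [add_mul, mul_add, map_add, h3sq] at this
    linear_combination (norm := abel) this
  have h3 : ∀ a, d3 a = 0 := by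
    have k : ∀ a, d3 a = - d3 (u * a) := by
      intro a
      have := h3l a u
      rw [hu] at this
      exact eq_neg_of_add_eq_zero_left this
    have k2 : ∀ a, d3 (u * a) = 0 := by
      intro a
      have h := k (u * a)
      rw [← mul_assoc, hu] at h
      have h' : (2 : ℂ) • d3 (u * a) = 0 := by
        rw [two_smul]; nth_rewrite 1 [h]; exact neg_add_cancel _
      exact (smul_eq_zero.mp h').resolve_left two_ne_zero
    intro a
    rw [k, k2, neg_zero]
  -- the fourth block vanishes
  have h4 : ∀ b, d4 b = 0 := by
    refine B_part hss d4 ?_ ?_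
    · intro b
      have := (hd 0 b).2
      simpa using this
    · intro b y
      have := (hcen 0 b).2
      simp only [map_zero, zero_add] at this
      exact (Semigroup.mem_center_iff.mp this y).symm
  simp only [h3, h4, map_zero, zero_smul, add_zero] at hd hcen
  have hd' := fun a b => (hd a b).1
  have hcen' := fun a b => (hcen a b).1
  have j1 : ∀ a, d1 (a * a) = d1 a * a + a * d1 a := by
    intro a
    simpa using hd' a 0
  have j2 : ∀ b, d2 (b * b) = (φ b + γ b) • d2 b := by
    intro b
    have := hd' 0 b
    simp at this
    rw [this, add_smul]
  have j3 : ∀ a b, (2 * θ b - φ b - γ b) • d1 a = d2 b * a + a * d2 b := by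
    intro a b
    have := hd' a b
    simp only [map_add, map_smul, j1, j2, add_mul, mul_add, smul_add] at this
    linear_combination (norm := module) this
  obtain ⟨b₀, hb₀⟩ : ∃ b, 2 * θ b - φ b - γ b ≠ 0 := by
    by_contra hcon
    push Not at hcon
    have hφγ : ∀ x, φ x = γ x := by
      intro x
      have h1 := hcon x
      have h2 := hcon (x * x)
      rw [hθmul, hφmul, hγmul] at h2
      have : (φ x - γ x) ^ 2 = 0 := by
        linear_combination (2 * θ x + φ x + γ x) * h1 - 2 * h2
      exact sub_eq_zero.mp (pow_eq_zero_iff (two_ne_zero) |>.mp this)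
    apply hθφ
    ext x
    have h1 := hcon x
    have h2 := hφγ x
    linear_combination h1 / 2 - h2 / 2
  obtain ⟨w, hw⟩ : ∃ w : A, ∀ a, d1 a = w * a + a * w := by
    refine ⟨(2 * θ b₀ - φ b₀ - γ b₀)⁻¹ • d2 b₀, fun a => ?_⟩
    rw [smul_mul_assoc, mul_smul_comm, ← smul_add, ← j3, smul_smul, inv_mul_cancel₀ hb₀, one_smul]
  have q1 : ∀ a, a * w * a = 0 := by
    intro a
    apply h2A
    have := j1 a
    rw [hw, hw] at this
    linear_combination (norm := noncomm_ring) -this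
  have q2 : u * w = 0 := by
    have := q1 u
    rwa [hu] at this
  have q3 : ∀ a, a * w = 0 := by
    intro a
    have h := q1 (a + u)
    have h1 := q1 a
    simp only [add_mul, mul_add, hu, h1, q2, zero_mul, zero_add, add_zero] at h
    exact h
  have q4 : w = 0 := by
    have h := hcen' u 0
    simp only [map_zero, add_zero, zero_smul, hw, q3, hu] at h
    rw [sub_zero] at h
    have := Semigroup.mem_center_iff.mp h u
    rw [hu, q2] at this
    exact this.symm
  have h1 : ∀ a, d1 a = 0 := by intro a; rw [hw, q4]; simp
  have h2 : ∀ b, d2 b = 0 := by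
    intro b
    have h := j3 u b
    rw [h1, smul_zero, hu] at h
    have h' := congrArg (fun t => u * t) h
    simp only [mul_add, mul_zero] at h'
    rw [← mul_assoc, hu] at h'
    rw [h2A _ h'.symm, add_zero] at h
    exact h.symm
  apply LinearMap.ext
  rintro ⟨a, b⟩
  rw [hdd, h1, h2, h3, h4]
  simp
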